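/- If λ_K · δ_max < K, then the unique global minimizer of ℓ is Y* = (I + λL − (λ_K/K)L⁻)^{-1} B; in particular, I + λL − (λ_K/K)L⁻ is invertible and ∇ℓ(Y*) = 0. -/

import Mathlib

open Matrix

/-- The node-embedding energy
`ℓ(Y) = ‖Y − B‖_F² + λ·tr(Yᵀ L Y) − (λ_K/K)·tr(Yᵀ L⁻ Y)`. -/
noncomputable def energy {n d : ℕ} (L Lneg : Matrix (Fin n) (Fin n) ℝ)
    (B : Matrix (Fin n) (Fin d) ℝ) (lam lamK : ℝ) (K : ℕ)
    (Y : Matrix (Fin n) (Fin d) ℝ) : ℝ :=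
  ((Y - B)ᵀ * (Y - B)).trace + lam * (Yᵀ * L * Y).trace
    - (lamK / K) * (Yᵀ * Lneg * Y).trace

/-- A symmetric matrix whose eigenvalues are at most `δ` is bounded by `δ • 1`. -/
lemma posSemidef_smul_one_sub {ι : Type*} [Fintype ι] [DecidableEq ι] {A : Matrix ι ι ℝ}
    (hA : A.IsHermitian) {δ : ℝ} (h : ∀ i, hA.eigenvalues i ≤ δ) :
    (δ • (1 : Matrix ι ι ℝ) - A).PosSemidef := by
  have hd : (diagonal fun i => δ - hA.eigenvalues i).PosSemidef :=
    PosSemidef.diagonal fun i => sub_nonneg.2 (h i)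
  have key : δ • (1 : Matrix ι ι ℝ) - A = (hA.eigenvectorUnitary : Matrix ι ι ℝ) *
      (diagonal fun i => δ - hA.eigenvalues i) * (hA.eigenvectorUnitary : Matrix ι ι ℝ)ᴴ := by
    have hU : (hA.eigenvectorUnitary : Matrix ι ι ℝ) *
        (hA.eigenvectorUnitary : Matrix ι ι ℝ)ᴴ = 1 :=
      Unitary.mul_star_self_of_mem hA.eigenvectorUnitary.2
    have hs : A = (hA.eigenvectorUnitary : Matrix ι ι ℝ) * diagonal hA.eigenvalues *
        (hA.eigenvectorUnitary : Matrix ι ι ℝ)ᴴ := by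
      simpa [Unitary.conjStarAlgAut_apply, Function.comp_def, star_eq_conjTranspose]
        using hA.spectral_theorem
    have hdiag : (diagonal fun i => δ - hA.eigenvalues i) =
        δ • (1 : Matrix ι ι ℝ) - diagonal hA.eigenvalues := by
      rw [smul_one_eq_diagonal, diagonal_sub]
    rw [hdiag, mul_sub, sub_mul, ← hs, mul_smul_comm, mul_one, smul_mul_assoc, hU]
  rw [key]
  exact hd.mul_mul_conjTranspose_same _

/-- The matrix `1 + a • L - c • N` is positive definite as soon as `c * δ < 1`, where `δ` bounds
the eigenvalues of `N` from above. -/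
lemma posDef_one_add_smul_sub_smul {ι : Type*} [Fintype ι] [DecidableEq ι] {L N : Matrix ι ι ℝ}
    (hL : L.PosSemidef) (hN : N.IsHermitian) {a c δ : ℝ} (ha : 0 ≤ a) (hc : 0 ≤ c)
    (h : ∀ i, hN.eigenvalues i ≤ δ) (hcδ : c * δ < 1) :
    (1 + a • L - c • N).PosDef := by
  have h1 : ((1 - c * δ) • (1 : Matrix ι ι ℝ)).PosDef := PosDef.one.smul (sub_pos.2 hcδ)
  have h2 := (h1.add_posSemidef (hL.smul ha)).add_posSemidef
    ((posSemidef_smul_one_sub hN h).smul hc)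
  convert h2 using 1
  module

/-- A positive definite quadratic form in a matrix variable vanishes only at zero. -/
lemma Matrix.PosDef.eq_zero_of_trace_eq_zero {m ι : Type*} [Fintype m] [Fintype ι]
    {M : Matrix ι ι ℝ} (hM : M.PosDef) {Z : Matrix ι m ℝ} (h : (Zᵀ * M * Z).trace = 0) :
    Z = 0 := by
  classical
  have hp := hM.posSemidef.conjTranspose_mul_mul_same Z
  have hz : Zᴴ * M * Z = 0 := hp.trace_eq_zero_iff.1 (by simpa using h)
  by_contra hne
  obtain ⟨x, hx⟩ : ∃ x, Z *ᵥ x ≠ 0 := by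
    by_contra! hall
    exact hne (Matrix.ext_of_mulVec_single fun i => by rw [hall, zero_mulVec])
  have := hM.dotProduct_mulVec_pos hx
  rw [star_mulVec, ← dotProduct_mulVec, mulVec_mulVec, mulVec_mulVec, hz] at this
  simp at this

/-- Completing the square in the node-embedding energy. -/
lemma energy_eq_trace_add_energy {n d : ℕ} {L Lneg : Matrix (Fin n) (Fin n) ℝ}
    {B : Matrix (Fin n) (Fin d) ℝ} {lam lamK : ℝ} {K : ℕ}
    (hM : (1 + lam • L - (lamK / K) • Lneg)ᵀ = 1 + lam • L - (lamK / K) • Lneg)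
    {Z : Matrix (Fin n) (Fin d) ℝ} (hZ : (1 + lam • L - (lamK / K) • Lneg) * Z = B)
    (Y : Matrix (Fin n) (Fin d) ℝ) :
    energy L Lneg B lam lamK K Y =
      ((Y - Z)ᵀ * (1 + lam • L - (lamK / K) • Lneg) * (Y - Z)).trace +
        energy L Lneg B lam lamK K Z := by
  have expand : ∀ W : Matrix (Fin n) (Fin d) ℝ, energy L Lneg B lam lamK K W =
      (Wᵀ * (1 + lam • L - (lamK / K) • Lneg) * W).trace - 2 * (Wᵀ * B).trace
        + (Bᵀ * B).trace := by
    intro W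
    have hsymm : (Bᵀ * W).trace = (Wᵀ * B).trace := by
      rw [← trace_transpose, transpose_mul, transpose_transpose]
    simp only [energy, transpose_sub, Matrix.mul_sub, Matrix.sub_mul, Matrix.mul_add,
      Matrix.add_mul, Matrix.mul_one, trace_sub, trace_add, Matrix.mul_smul, Matrix.smul_mul,
      trace_smul, smul_eq_mul, hsymm]
    ring
  rw [expand Y, expand Z]
  generalize 1 + lam • L - (lamK / K) • Lneg = M at *
  subst hZ
  have hsymm : (Zᵀ * (M * Y)).trace = (Yᵀ * (M * Z)).trace := by
    rw [← trace_transpose, transpose_mul, transpose_mul, transpose_transpose, hM, Matrix.mul_assoc]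
  simp only [transpose_sub, Matrix.mul_sub, Matrix.sub_mul, trace_sub, Matrix.mul_assoc, hsymm]
  ring

/-- if `λ_K · δ_max < K`, then `M = I + λL − (λ_K/K)L⁻` is invertible,
`Y* = M⁻¹ B` is the unique global minimizer of `ℓ`, and `∇ℓ(Y*) = 2[M Y* − B] = 0`. -/
theorem energy_unique_min_closed_form {n d : ℕ}
    (L Lneg : Matrix (Fin n) (Fin n) ℝ)
    (hL : L.PosSemidef) (hLneg : Lneg.PosSemidef)
    (B : Matrix (Fin n) (Fin d) ℝ)
    (lam lamK : ℝ) (hlam : 0 < lam) (hlamK : 0 ≤ lamK)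
    (K : ℕ) (hK : 1 ≤ K)
    (δmax : ℝ) (hδ : IsGreatest (Set.range hLneg.isHermitian.eigenvalues) δmax)
    (hcond : lamK * δmax < (K : ℝ)) :
    IsUnit (1 + lam • L - (lamK / K) • Lneg) ∧
    (∀ Y, energy L Lneg B lam lamK K ((1 + lam • L - (lamK / K) • Lneg)⁻¹ * B) ≤
        energy L Lneg B lam lamK K Y) ∧
    (∀ Y', (∀ Y, energy L Lneg B lam lamK K Y' ≤ energy L Lneg B lam lamK K Y) →
        Y' = (1 + lam • L - (lamK / K) • Lneg)⁻¹ * B) ∧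
    (2 : ℝ) • ((1 + lam • L - (lamK / K) • Lneg) *
        ((1 + lam • L - (lamK / K) • Lneg)⁻¹ * B) - B) = 0 := by
  have hK0 : (0 : ℝ) < K := by exact_mod_cast hK
  have hpd : (1 + lam • L - (lamK / K) • Lneg).PosDef :=
    posDef_one_add_smul_sub_smul hL hLneg.isHermitian hlam.le (by positivity)
      (fun i => hδ.2 ⟨i, rfl⟩) (by rwa [div_mul_eq_mul_div, div_lt_one hK0])
  have hsq := fun Z hZ => energy_eq_trace_add_energy (B := B) (Z := Z)
    (by simpa only [conjTranspose_eq_transpose_of_trivial] using hpd.isHermitian.eq) hZ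
  have hB : (1 + lam • L - (lamK / K) • Lneg) *
      ((1 + lam • L - (lamK / K) • Lneg)⁻¹ * B) = B :=
    mul_nonsing_inv_cancel_left _ _ ((isUnit_iff_isUnit_det _).1 hpd.isUnit)
  refine ⟨hpd.isUnit, fun Y => ?_, fun Y' hY' => ?_, by rw [hB, sub_self, smul_zero]⟩
  · rw [hsq _ hB Y]
    exact le_add_of_nonneg_left
      (by simpa using (hpd.posSemidef.conjTranspose_mul_mul_same
        (Y - (1 + lam • L - (lamK / K) • Lneg)⁻¹ * B)).trace_nonneg)
  · have hle := hY' ((1 + lam • L - (lamK / K) • Lneg)⁻¹ * B)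
    rw [hsq _ hB Y', add_le_iff_nonpos_left] at hle
    refine sub_eq_zero.1 (hpd.eq_zero_of_trace_eq_zero (le_antisymm hle ?_))
    simpa using (hpd.posSemidef.conjTranspose_mul_mul_same
      (Y' - (1 + lam • L - (lamK / K) • Lneg)⁻¹ * B)).trace_nonneg
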